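/- arXiv:1503.04578 — 3 statements merged into one kernel-verified Lean document; each statement's English description precedes it below -/
import Mathlib

section
/- Let φ : ℝ² → ℂ be a Schwartz function and write Δφ = ∂²φ/∂x₁² + ∂²φ/∂x₂². Then (1/(2π)) ∫_{ℝ²} log‖x‖ · Δφ(x) dx = φ(0). In other words, the function K_Δ(x) = (1/(2π)) log‖x‖ is a fundamental solution of the Laplace operator in two variables: Δ K_Δ = δ in the sense of tempered distributions. -/
open MeasureTheory

/-- The second directional derivative of `f` at `x` in the direction `v`. -/
noncomputable def secondDeriv2 {F : Type*} [NormedAddCommGroup F] [NormedSpace ℝ F]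
    (f : EuclideanSpace ℝ (Fin 2) → F) (x v : EuclideanSpace ℝ (Fin 2)) : F :=
  fderiv ℝ (fun y => fderiv ℝ f y v) x v

/-- The Laplacian of `f : ℝ² → F` at `x`, as the sum of the two second partial derivatives. -/
noncomputable def laplacian2 {F : Type*} [NormedAddCommGroup F] [NormedSpace ℝ F]
    (f : EuclideanSpace ℝ (Fin 2) → F) (x : EuclideanSpace ℝ (Fin 2)) : F :=
  secondDeriv2 f x (EuclideanSpace.single 0 (1:ℝ)) +
    secondDeriv2 f x (EuclideanSpace.single 1 (1:ℝ))

open Filter Topology Set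
open scoped LineDeriv

section Regularization

section Normed

variable {E : Type*} [NormedAddCommGroup E]

/-- The smooth regularization `½ log (‖x‖² + s)` of `log ‖x‖`. -/
noncomputable def regLogNorm (s : ℝ) (x : E) : ℝ := 1 / 2 * Real.log (‖x‖ ^ 2 + s)

lemma continuous_regLogNorm {s : ℝ} (hs : 0 < s) : Continuous (regLogNorm (E := E) s) := by
  unfold regLogNorm
  refine continuous_const.mul (Continuous.log (by fun_prop) fun x => ?_)
  positivity

lemma abs_regLogNorm_le {s : ℝ} (hs : 0 < s) (x : E) :
    |regLogNorm s x| ≤ (1 + s + 1 / s) * (1 + ‖x‖ ^ 2) := by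
  have hx := sq_nonneg ‖x‖
  have hN : 0 < ‖x‖ ^ 2 + s := by positivity
  have h1 := Real.log_le_sub_one_of_pos hN
  have h2 := Real.one_sub_inv_le_log_of_pos hN
  have h3 : (‖x‖ ^ 2 + s)⁻¹ ≤ 1 / s := by rw [one_div]; gcongr; linarith
  have h4 : 0 < 1 / s := by positivity
  unfold regLogNorm
  rw [abs_le]
  constructor <;> nlinarith [mul_nonneg hs.le hx, mul_nonneg h4.le hx]

lemma abs_regLogNorm_le_of_le_one {s : ℝ} (hs : 0 < s) (hs1 : s ≤ 1) {x : E} (hx : x ≠ 0) :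
    |regLogNorm s x| ≤ ‖x‖⁻¹ * (1 + ‖x‖) ^ 3 := by
  have hr : 0 < ‖x‖ := norm_pos_iff.2 hx
  have hN : 0 < ‖x‖ ^ 2 + s := by positivity
  have h1 := Real.log_le_sub_one_of_pos hN
  have h2 : 2 * Real.log ‖x‖ ≤ Real.log (‖x‖ ^ 2 + s) := by
    have := Real.log_le_log (by positivity) (by linarith : ‖x‖ ^ 2 ≤ ‖x‖ ^ 2 + s)
    rwa [Real.log_pow] at this
  have h3 := Real.one_sub_inv_le_log_of_pos hr
  have h4 : ‖x‖⁻¹ * (1 + ‖x‖) ^ 3 = ‖x‖⁻¹ + 3 + 3 * ‖x‖ + ‖x‖ ^ 2 := by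
    field_simp
    ring
  have h5 : 0 < ‖x‖⁻¹ := by positivity
  unfold regLogNorm
  rw [h4, abs_le]
  constructor <;> nlinarith

lemma tendsto_regLogNorm {x : E} (hx : x ≠ 0) :
    Tendsto (fun s => regLogNorm s x) (𝓝 0) (𝓝 (Real.log ‖x‖)) := by
  have hr : ‖x‖ ^ 2 + 0 ≠ 0 := by simpa using hx
  have h : ContinuousAt (fun s => regLogNorm s x) 0 := by
    unfold regLogNorm
    exact continuousAt_const.mul (ContinuousAt.log (by fun_prop) hr)
  have h0 : regLogNorm 0 x = Real.log ‖x‖ := by simp [regLogNorm]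
  simpa only [ContinuousAt, h0] using h

end Normed

variable {E : Type*} [NormedAddCommGroup E] [InnerProductSpace ℝ E]

/-- The derivative of `regLogNorm s` at `x` in the direction `v`. -/
noncomputable def regLogNormDeriv (s : ℝ) (v x : E) : ℝ := inner ℝ x v / (‖x‖ ^ 2 + s)

/-- The second derivative of `regLogNorm s` at `x` in the direction of a unit vector `v`. -/
noncomputable def regLogNormDerivTwo (s : ℝ) (v x : E) : ℝ :=
  1 / (‖x‖ ^ 2 + s) - 2 * inner ℝ x v ^ 2 / (‖x‖ ^ 2 + s) ^ 2

lemma continuous_regLogNormDeriv {s : ℝ} (hs : 0 < s) (v : E) :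
    Continuous (regLogNormDeriv s v) := by
  unfold regLogNormDeriv
  refine Continuous.div (by fun_prop) (by fun_prop) fun x => ?_
  positivity

lemma continuous_regLogNormDerivTwo {s : ℝ} (hs : 0 < s) (v : E) :
    Continuous (regLogNormDerivTwo s v) := by
  unfold regLogNormDerivTwo
  refine Continuous.sub (Continuous.div (by fun_prop) (by fun_prop) fun x => ?_)
    (Continuous.div (by fun_prop) (by fun_prop) fun x => ?_) <;> positivity

lemma hasLineDerivAt_regLogNorm {s : ℝ} (hs : 0 < s) (v x : E) :
    HasLineDerivAt ℝ (regLogNorm s) (regLogNormDeriv s v x) x v := by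
  have hN : ‖x‖ ^ 2 + s ≠ 0 := by positivity
  have h := (((hasStrictFDerivAt_norm_sq x).hasFDerivAt.add_const s).log hN).const_mul (1 / 2)
  convert! h.hasLineDerivAt v using 1
  simp [regLogNormDeriv, nsmul_eq_mul]
  ring

lemma hasLineDerivAt_regLogNormDeriv {s : ℝ} (hs : 0 < s) {v : E} (hv : ‖v‖ = 1) (x : E) :
    HasLineDerivAt ℝ (regLogNormDeriv s v) (regLogNormDerivTwo s v x) x v := by
  have hN : ‖x‖ ^ 2 + s ≠ 0 := by positivity
  have hl : HasLineDerivAt ℝ (fun y : E => inner ℝ y v) (1 : ℝ) x v := by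
    have := ((hasFDerivAt_id (𝕜 := ℝ) x).inner ℝ (hasFDerivAt_const v x)).hasLineDerivAt v
    simpa [hv] using this
  have hd := ((hasStrictFDerivAt_norm_sq x).hasFDerivAt.add_const s).hasLineDerivAt v
  unfold HasLineDerivAt at *
  convert! hl.div hd (by simpa using hN) using 1
  simp only [regLogNormDerivTwo, zero_smul, add_zero, FunLike.coe_smul, Pi.smul_apply,
    innerSL_apply_apply, nsmul_eq_mul]
  field_simp
  push_cast
  ring

lemma abs_regLogNormDeriv_le {s : ℝ} (hs : 0 < s) {v : E} (hv : ‖v‖ = 1) (x : E) :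
    |regLogNormDeriv s v x| ≤ 1 / s * (1 + ‖x‖ ^ 2) := by
  have h1 : |inner ℝ x v| ≤ ‖x‖ := by simpa [hv] using abs_real_inner_le_norm x v
  have h2 : |inner ℝ x v| ≤ 1 + ‖x‖ ^ 2 := by nlinarith [sq_nonneg (‖x‖ - 1)]
  unfold regLogNormDeriv
  rw [abs_div, abs_of_pos (by positivity : 0 < ‖x‖ ^ 2 + s), one_div_mul_eq_div]
  gcongr
  nlinarith [sq_nonneg ‖x‖]

lemma abs_regLogNormDerivTwo_le {s : ℝ} (hs : 0 < s) {v : E} (hv : ‖v‖ = 1) (x : E) :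
    |regLogNormDerivTwo s v x| ≤ (1 / s + 2 / s ^ 2) * (1 + ‖x‖ ^ 2) := by
  have hx := sq_nonneg ‖x‖
  have h1 : |inner ℝ x v| ≤ ‖x‖ := by simpa [hv] using abs_real_inner_le_norm x v
  have h2 : inner ℝ x v ^ 2 ≤ ‖x‖ ^ 2 := sq_le_sq.2 (by simpa using h1)
  have hsN : s ≤ ‖x‖ ^ 2 + s := by linarith
  have h3 : 1 / (‖x‖ ^ 2 + s) ≤ 1 / s := by gcongr
  have h4 : 2 * inner ℝ x v ^ 2 / (‖x‖ ^ 2 + s) ^ 2 ≤ 2 / s ^ 2 * ‖x‖ ^ 2 := by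
    rw [div_mul_eq_mul_div]
    gcongr
  have h5 : 0 ≤ 1 / (‖x‖ ^ 2 + s) := by positivity
  have h6 : 0 ≤ 2 * inner ℝ x v ^ 2 / (‖x‖ ^ 2 + s) ^ 2 := by positivity
  have h7 : 0 < 1 / s := by positivity
  have h8 : 0 < 2 / s ^ 2 := by positivity
  unfold regLogNormDerivTwo
  rw [abs_le]
  constructor <;> nlinarith [mul_nonneg h7.le hx]

variable [FiniteDimensional ℝ E] [MeasurableSpace E] [BorelSpace E]

lemma SchwartzMap.integrable_smul_of_abs_le {f : E → ℝ} (hf : Continuous f) {C : ℝ}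
    (hC : ∀ x, |f x| ≤ C * (1 + ‖x‖ ^ 2)) (ψ : SchwartzMap E ℂ) :
    Integrable (fun x => f x • ψ x) := by
  refine Integrable.mono' (((ψ.integrable_pow_mul volume 0).add
    (ψ.integrable_pow_mul volume 2)).const_mul C)
    (hf.smul ψ.continuous).aestronglyMeasurable (.of_forall fun x => ?_)
  rw [norm_smul, Real.norm_eq_abs]
  calc |f x| * ‖ψ x‖ ≤ C * (1 + ‖x‖ ^ 2) * ‖ψ x‖ := by gcongr; exact hC x
    _ = _ := by simp; ring

lemma SchwartzMap.integral_smul_lineDerivOp_eq_neg {f f' : E → ℝ} {v : E}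
    (hf : ∀ x, HasLineDerivAt ℝ f (f' x) x v)
    (hfi : ∀ ψ : SchwartzMap E ℂ, Integrable fun x => f x • ψ x)
    (hfi' : ∀ ψ : SchwartzMap E ℂ, Integrable fun x => f' x • ψ x) (ψ : SchwartzMap E ℂ) :
    ∫ x, f x • ∂_{v} ψ x = -∫ x, f' x • ψ x := by
  have hd (x : E) : HasLineDerivAt ℝ ψ (∂_{v} ψ x) x v :=
    ψ.differentiableAt.hasFDerivAt.hasLineDerivAt v
  exact integral_bilinear_hasLineDerivAt_right_eq_neg_left_of_integrable (W := ℂ)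
    (B := ContinuousLinearMap.lsmul ℝ ℝ) (hfi' ψ) (hfi (∂_{v} ψ)) (hfi ψ)
    (fun x _ => hf x) (fun x _ => hd x)

lemma integral_regLogNorm_smul_lineDeriv {s : ℝ} (hs : 0 < s) {v : E} (hv : ‖v‖ = 1)
    (φ : SchwartzMap E ℂ) :
    ∫ x, regLogNorm s x • ∂_{v} (∂_{v} φ) x = ∫ x, regLogNormDerivTwo s v x • φ x := by
  have h0 (ψ : SchwartzMap E ℂ) : Integrable fun x => regLogNorm s x • ψ x :=
    ψ.integrable_smul_of_abs_le (continuous_regLogNorm hs) (abs_regLogNorm_le hs)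
  have h1 (ψ : SchwartzMap E ℂ) : Integrable fun x => regLogNormDeriv s v x • ψ x :=
    ψ.integrable_smul_of_abs_le (continuous_regLogNormDeriv hs v) (abs_regLogNormDeriv_le hs hv)
  have h2 (ψ : SchwartzMap E ℂ) : Integrable fun x => regLogNormDerivTwo s v x • ψ x :=
    ψ.integrable_smul_of_abs_le (continuous_regLogNormDerivTwo hs v)
      (abs_regLogNormDerivTwo_le hs hv)
  rw [SchwartzMap.integral_smul_lineDerivOp_eq_neg (hasLineDerivAt_regLogNorm hs v) h0 h1,
    SchwartzMap.integral_smul_lineDerivOp_eq_neg (hasLineDerivAt_regLogNormDeriv hs hv) h1 h2,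
    neg_neg]

end Regularization

section Plane

local notation "ℝ²" => EuclideanSpace ℝ (Fin 2)

lemma integral_inv_one_add_norm_sq_sq :
    ∫ x : ℝ², Real.pi⁻¹ / (1 + ‖x‖ ^ 2) ^ 2 = 1 := by
  have hball : (volume : Measure ℝ²).real (Metric.ball 0 1) = Real.pi := by
    simp [Measure.real, EuclideanSpace.volume_ball_fin_two, Real.pi_pos.le]
  have hint : ∫ y in Ioi (0 : ℝ), y * (Real.pi⁻¹ / (1 + y ^ 2) ^ 2)
      = 0 - -(Real.pi⁻¹ / 2) / (1 + (0 : ℝ) ^ 2) := by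
    refine integral_Ioi_of_hasDerivAt_of_nonneg' (g := fun y => -(Real.pi⁻¹ / 2) / (1 + y ^ 2))
      (fun y _ => ?_) (fun y hy => ?_) ?_
    · have hN : 1 + y ^ 2 ≠ 0 := by positivity
      convert! (hasDerivAt_const y (-(Real.pi⁻¹ / 2))).div
        (((hasDerivAt_id y).pow 2).const_add 1) hN using 1
      simp
      ring
    · have : 0 < y := hy
      positivity
    · exact tendsto_const_nhds.div_atTop
        (tendsto_atTop_add_const_left _ _ (tendsto_pow_atTop two_ne_zero))
  rw [integral_fun_norm_addHaar volume fun r => Real.pi⁻¹ / (1 + r ^ 2) ^ 2, hball]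
  simp only [finrank_euclideanSpace, Fintype.card_fin, Nat.add_one_sub_one, pow_one, smul_eq_mul,
    hint]
  simp
  field_simp

lemma tendsto_norm_sq_mul_inv_one_add_norm_sq_sq :
    Tendsto (fun x : ℝ² => ‖x‖ ^ 2 * (Real.pi⁻¹ / (1 + ‖x‖ ^ 2) ^ 2))
      (Bornology.cobounded ℝ²) (𝓝 0) := by
  have h : Tendsto (fun x : ℝ² => Real.pi⁻¹ / (1 + ‖x‖ ^ 2)) (Bornology.cobounded ℝ²) (𝓝 0) :=
    tendsto_const_nhds.div_atTop (tendsto_atTop_add_const_left _ _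
      ((tendsto_pow_atTop two_ne_zero).comp tendsto_norm_cobounded_atTop))
  refine squeeze_zero (fun x => by positivity) (fun x => ?_) h
  rw [← mul_div_assoc, div_le_div_iff₀ (by positivity) (by positivity)]
  have : 0 < Real.pi⁻¹ := by positivity
  nlinarith [mul_nonneg this.le (by positivity : 0 ≤ 1 + ‖x‖ ^ 2)]

lemma laplacian2_eq_lineDeriv (φ : SchwartzMap ℝ² ℂ) (x : ℝ²) :
    laplacian2 φ x =
      ∂_{EuclideanSpace.single (0 : Fin 2) (1 : ℝ)}
        (∂_{EuclideanSpace.single (0 : Fin 2) (1 : ℝ)} φ) x +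
      ∂_{EuclideanSpace.single (1 : Fin 2) (1 : ℝ)}
        (∂_{EuclideanSpace.single (1 : Fin 2) (1 : ℝ)} φ) x :=
  rfl

lemma regLogNormDerivTwo_single_add {s : ℝ} (hs : 0 < s) (x : ℝ²) :
    regLogNormDerivTwo s (EuclideanSpace.single 0 1) x +
      regLogNormDerivTwo s (EuclideanSpace.single 1 1) x = 2 * s / (‖x‖ ^ 2 + s) ^ 2 := by
  have hN : ‖x‖ ^ 2 + s ≠ 0 := by positivity
  have hx : ‖x‖ ^ 2 = x 0 ^ 2 + x 1 ^ 2 := by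
    simp [EuclideanSpace.norm_sq_eq, Fin.sum_univ_two]
  simp only [regLogNormDerivTwo, EuclideanSpace.inner_single_right]
  field_simp
  simp [hx]
  ring

lemma integral_regLogNorm_smul_laplacian2 {s : ℝ} (hs : 0 < s) (φ : SchwartzMap ℝ² ℂ) :
    ∫ x, regLogNorm s x • laplacian2 φ x = ∫ x, (2 * s / (‖x‖ ^ 2 + s) ^ 2) • φ x := by
  have h0 (ψ : SchwartzMap ℝ² ℂ) : Integrable fun x => regLogNorm s x • ψ x :=
    ψ.integrable_smul_of_abs_le (continuous_regLogNorm hs) (abs_regLogNorm_le hs)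
  have hv (i : Fin 2) : ‖(EuclideanSpace.single i 1 : ℝ²)‖ = 1 := by simp
  have h2 (i : Fin 2) :
      Integrable fun x : ℝ² => regLogNormDerivTwo s (EuclideanSpace.single i 1) x • φ x :=
    φ.integrable_smul_of_abs_le (continuous_regLogNormDerivTwo hs _)
      (abs_regLogNormDerivTwo_le hs (hv i))
  simp only [laplacian2_eq_lineDeriv, smul_add]
  rw [integral_add (h0 _) (h0 _), integral_regLogNorm_smul_lineDeriv hs (hv 0),
    integral_regLogNorm_smul_lineDeriv hs (hv 1), ← integral_add (h2 0) (h2 1)]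
  simp only [← add_smul, regLogNormDerivTwo_single_add hs]

lemma integrable_inv_norm_mul_one_add_norm_rpow :
    Integrable fun x : ℝ² => ‖x‖⁻¹ * (1 + ‖x‖) ^ (-2 : ℝ) := by
  rw [integrable_fun_norm_addHaar volume (f := fun r => r⁻¹ * (1 + r) ^ (-2 : ℝ))]
  have h : Integrable fun r : ℝ => (1 + ‖r‖) ^ (-2 : ℝ) :=
    integrable_one_add_norm (by simp)
  refine h.integrableOn.congr_fun (fun r (hr : 0 < r) => ?_) measurableSet_Ioi
  simp [abs_of_pos hr, hr.ne']

lemma tendsto_integral_regLogNorm_smul (ψ : SchwartzMap ℝ² ℂ) :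
    Tendsto (fun s => ∫ x, regLogNorm s x • ψ x) (𝓝[>] 0)
      (𝓝 (∫ x, Real.log ‖x‖ • ψ x)) := by
  obtain ⟨C, hC⟩ : ∃ C, ∀ x, (1 + ‖x‖) ^ 5 * ‖ψ x‖ ≤ C :=
    ⟨_, fun x => by
      simpa using SchwartzMap.one_add_le_sup_seminorm_apply (𝕜 := ℝ) (m := (5, 0))
        le_rfl le_rfl ψ x⟩
  have hne : ∀ᵐ x : ℝ², x ≠ 0 := Measure.ae_ne volume 0
  refine tendsto_integral_filter_of_dominated_convergence
    (fun x => C * (‖x‖⁻¹ * (1 + ‖x‖) ^ (-2 : ℝ))) ?_ ?_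
    (integrable_inv_norm_mul_one_add_norm_rpow.const_mul C) ?_
  · filter_upwards [self_mem_nhdsWithin] with s hs
    exact ((continuous_regLogNorm hs).smul ψ.continuous).aestronglyMeasurable
  · filter_upwards [Ioc_mem_nhdsGT zero_lt_one] with s hs
    filter_upwards [hne] with x hx
    have hr : 0 < ‖x‖ := norm_pos_iff.2 hx
    have hb := abs_regLogNorm_le_of_le_one hs.1 hs.2 hx
    rw [norm_smul, Real.norm_eq_abs, Real.rpow_neg (by positivity), Real.rpow_ofNat]
    calc |regLogNorm s x| * ‖ψ x‖ ≤ ‖x‖⁻¹ * (1 + ‖x‖) ^ 3 * ‖ψ x‖ := by gcongr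
      _ = (1 + ‖x‖) ^ 5 * ‖ψ x‖ * (‖x‖⁻¹ * ((1 + ‖x‖) ^ 2)⁻¹) := by field_simp
      _ ≤ _ := by gcongr; exact hC x
  · filter_upwards [hne] with x hx
    exact ((tendsto_regLogNorm hx).mono_left nhdsWithin_le_nhds).smul_const _

lemma tendsto_integral_regLogNorm_smul_laplacian2 (φ : SchwartzMap ℝ² ℂ) :
    Tendsto (fun c : ℝ => ∫ x, regLogNorm (c⁻¹ ^ 2) x • laplacian2 φ x) atTop
      (𝓝 ((2 * Real.pi) • φ 0)) := by
  have h := (tendsto_integral_comp_smul_smul_of_integrable (μ := volume)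
    (φ := fun x : ℝ² => Real.pi⁻¹ / (1 + ‖x‖ ^ 2) ^ 2) (fun x => by positivity)
    integral_inv_one_add_norm_sq_sq
    (by simpa using tendsto_norm_sq_mul_inv_one_add_norm_sq_sq)
    (φ.integrable (μ := volume)) φ.continuous.continuousAt).const_smul (2 * Real.pi)
  refine h.congr' ?_
  filter_upwards [eventually_gt_atTop 0] with c hc
  rw [integral_regLogNorm_smul_laplacian2 (by positivity), ← integral_smul]
  refine integral_congr_ae (.of_forall fun x => ?_)
  simp only [smul_smul, finrank_euclideanSpace, Fintype.card_fin, norm_smul, Real.norm_eq_abs,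
    abs_of_pos hc]
  congr 1
  field_simp
  ring

end Plane

/-- `K_Δ(x) = (1/(2π)) log ‖x‖` is a fundamental solution of the Laplacian in two variables:
for every Schwartz function `φ : ℝ² → ℂ`,
`(1/(2π)) ∫_{ℝ²} log ‖x‖ · Δφ(x) dx = φ(0)`. -/
theorem fundamental_solution_laplace_two_dim
    (φ : SchwartzMap (EuclideanSpace ℝ (Fin 2)) ℂ) :
    (1 / (2 * Real.pi) : ℂ) *
        ∫ x : EuclideanSpace ℝ (Fin 2), (Real.log ‖x‖ : ℂ) * laplacian2 (⇑φ) x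
      = φ 0 := by
  obtain ⟨ψ, hψ⟩ : ∃ ψ : SchwartzMap (EuclideanSpace ℝ (Fin 2)) ℂ, ⇑ψ = laplacian2 φ :=
    ⟨∂_{EuclideanSpace.single (0 : Fin 2) (1 : ℝ)} (∂_{EuclideanSpace.single (0 : Fin 2) (1 : ℝ)} φ)
      + ∂_{EuclideanSpace.single (1 : Fin 2) (1 : ℝ)}
        (∂_{EuclideanSpace.single (1 : Fin 2) (1 : ℝ)} φ),
      funext fun x => (laplacian2_eq_lineDeriv φ x).symm⟩
  have hs : Tendsto (fun c : ℝ => c⁻¹ ^ 2) atTop (𝓝[>] 0) := by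
    refine tendsto_nhdsWithin_iff.2 ⟨?_, ?_⟩
    · simpa using (tendsto_inv_atTop_zero (𝕜 := ℝ)).pow 2
    · filter_upwards [eventually_gt_atTop 0] with c hc
      exact pow_pos (inv_pos.2 hc) 2
  have hlim := (tendsto_integral_regLogNorm_smul ψ).comp hs
  rw [hψ] at hlim
  have key := tendsto_nhds_unique hlim (tendsto_integral_regLogNorm_smul_laplacian2 φ)
  simp only [Complex.real_smul] at key
  rw [key]
  have hpi : (Real.pi : ℂ) ≠ 0 := by exact_mod_cast Real.pi_ne_zero
  push_cast
  field_simp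
end

section
/- Let f : ℝ² → ℂ be a smooth compactly supported function, and define the Newtonian (logarithmic) potential u(x) = (1/(2π)) ∫_{ℝ²} log‖x − y‖ f(y) dy. Then u is twice continuously differentiable on ℝ² and Δu(x) = ∂²u/∂x₁²(x) + ∂²u/∂x₂²(x) = f(x) for every x ∈ ℝ². -/
open MeasureTheory

open Filter Topology Module Set

open scoped Convolution

/-- The Euclidean plane. -/
local notation "Plane" => EuclideanSpace ℝ (Fin 2)

/-- The function `log ‖·‖` is locally integrable on the plane. -/
lemma locallyIntegrable_log_norm : LocallyIntegrable (fun z : Plane => Real.log ‖z‖) := by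
  intro x
  refine ⟨Metric.ball 0 (‖x‖ + 1), Metric.isOpen_ball.mem_nhds (by simp), ?_⟩
  rw [← integrable_indicator_iff Metric.isOpen_ball.measurableSet]
  have hradial : (Metric.ball (0 : Plane) (‖x‖ + 1)).indicator (fun z => Real.log ‖z‖) =
      fun z => (Iio (‖x‖ + 1)).indicator Real.log ‖z‖ := by
    ext z
    simp [indicator]
  rw [hradial, integrable_fun_norm_addHaar volume (f := (Iio (‖x‖ + 1)).indicator Real.log)]
  have hmul : (fun y : ℝ => y ^ (finrank ℝ Plane - 1) • (Iio (‖x‖ + 1)).indicator Real.log y) =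
      (Iio (‖x‖ + 1)).indicator (fun y => y * Real.log y) := by
    ext y
    simp [indicator]
  rw [hmul, IntegrableOn, integrable_indicator_iff measurableSet_Iio, IntegrableOn,
    Measure.restrict_restrict measurableSet_Iio]
  exact (Real.continuous_mul_log.integrableOn_Icc (a := 0) (b := ‖x‖ + 1)).mono_set
    fun y hy => ⟨hy.2.le, hy.1.le⟩

/-- The standard planar bubble `1 / (π (1 + ‖w‖²)²)` has total mass one. -/
lemma integral_bubble : ∫ w : Plane, (1 / Real.pi) * (1 / (1 + ‖w‖ ^ 2) ^ 2) = 1 := by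
  have hvol : volume.real (Metric.ball (0 : Plane) 1) = Real.pi := by
    simp [Measure.real, EuclideanSpace.volume_ball_fin_two, Real.pi_pos.le]
  have hradial : ∫ y in Ioi (0 : ℝ), 2 * y / (1 + y ^ 2) ^ 2 = 0 - -(1 + (0 : ℝ) ^ 2)⁻¹ := by
    refine integral_Ioi_of_hasDerivAt_of_nonneg' (g := fun y => -(1 + y ^ 2)⁻¹) ?_ ?_ ?_
    · intro y _
      have hne : 1 + y ^ 2 ≠ 0 := by positivity
      refine (((hasDerivAt_pow 2 y).const_add 1).inv hne).neg.congr_deriv ?_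
      push_cast
      ring
    · intro y hy
      have : (0 : ℝ) < y := hy
      positivity
    · rw [← neg_zero]
      refine (tendsto_inv_atTop_zero.comp ?_).neg
      exact tendsto_atTop_add_const_left _ _ (tendsto_pow_atTop two_ne_zero)
  rw [integral_const_mul,
    integral_fun_norm_addHaar volume (fun r : ℝ => 1 / (1 + r ^ 2) ^ 2), hvol]
  have hhalf : ∫ y in Ioi (0 : ℝ), y ^ (finrank ℝ Plane - 1) • (1 / (1 + y ^ 2) ^ 2) = 1 / 2 := by
    calc _ = ∫ y in Ioi (0 : ℝ), (1 / 2) * (2 * y / (1 + y ^ 2) ^ 2) := by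
          congr 1
          ext y
          simp
          ring
      _ = _ := by rw [integral_const_mul, hradial]; norm_num
  rw [hhalf]
  have := Real.pi_ne_zero
  simp
  field_simp

/-- The rescaled bubbles `a / (π (‖z‖² + a)²)`, with `a = c⁻²`, concentrate at the origin. -/
lemma tendsto_integral_bubble {F : Type*} [NormedAddCommGroup F] [NormedSpace ℝ F]
    [CompleteSpace F] {g : Plane → F} (hg : Integrable g) (hg0 : ContinuousAt g 0) :
    Tendsto (fun c : ℝ => ∫ z : Plane,
      (1 / Real.pi * ((c⁻¹) ^ 2 / (‖z‖ ^ 2 + (c⁻¹) ^ 2) ^ 2)) • g z) atTop (𝓝 (g 0)) := by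
  have hdecay : Tendsto (fun w : Plane => ‖w‖ ^ finrank ℝ Plane *
      ((1 / Real.pi) * (1 / (1 + ‖w‖ ^ 2) ^ 2))) (Bornology.cobounded Plane) (𝓝 0) := by
    have hlim : Tendsto (fun w : Plane => (1 / Real.pi) * (1 + ‖w‖ ^ 2)⁻¹)
        (Bornology.cobounded Plane) (𝓝 ((1 / Real.pi) * 0)) := by
      refine (tendsto_inv_atTop_zero.comp ?_).const_mul _
      exact tendsto_atTop_add_const_left _ _
        ((tendsto_pow_atTop two_ne_zero).comp tendsto_norm_cobounded_atTop)
    rw [mul_zero] at hlim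
    refine squeeze_zero (fun w => by positivity) (fun w => ?_) hlim
    rw [finrank_euclideanSpace_fin, mul_left_comm]
    gcongr
    rw [mul_one_div, inv_eq_one_div, div_le_div_iff₀ (by positivity) (by positivity)]
    nlinarith [sq_nonneg ‖w‖]
  have hpeak := tendsto_integral_comp_smul_smul_of_integrable (μ := volume)
    (fun w : Plane => by positivity) integral_bubble hdecay hg hg0
  refine hpeak.congr' ?_
  filter_upwards [eventually_gt_atTop 0] with c hc
  congr 1
  ext z
  congr 1
  rw [finrank_euclideanSpace_fin, norm_smul, Real.norm_of_nonneg hc.le]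
  have := Real.pi_pos
  have : 0 < 1 + (c * ‖z‖) ^ 2 := by positivity
  field_simp
  ring

section RegularizedLog

variable {a : ℝ}

lemma contDiff_log_norm_sq_add (ha : 0 < a) {n : WithTop ℕ∞} :
    ContDiff ℝ n (fun z : Plane => Real.log (‖z‖ ^ 2 + a) / 2) :=
  (((contDiff_norm_sq ℝ).add contDiff_const).log fun z => by positivity).div_const 2

lemma hasFDerivAt_norm_sq_add (z : Plane) :
    HasFDerivAt (fun z : Plane => ‖z‖ ^ 2 + a) (2 • innerSL ℝ z) z :=
  (hasStrictFDerivAt_norm_sq z).hasFDerivAt.add_const a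

lemma fderiv_log_norm_sq_add (ha : 0 < a) (z v : Plane) :
    fderiv ℝ (fun z : Plane => Real.log (‖z‖ ^ 2 + a) / 2) z v =
      inner ℝ z v * (‖z‖ ^ 2 + a)⁻¹ := by
  have hne : ‖z‖ ^ 2 + a ≠ 0 := by positivity
  have h := ((hasFDerivAt_norm_sq_add (a := a) z).log hne).mul_const (2⁻¹ : ℝ)
  simp only [div_eq_mul_inv]
  rw [h.fderiv]
  simp
  ring

lemma secondDeriv2_log_norm_sq_add (ha : 0 < a) (z v : Plane) :
    secondDeriv2 (fun z : Plane => Real.log (‖z‖ ^ 2 + a) / 2) z v =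
      ‖v‖ ^ 2 / (‖z‖ ^ 2 + a) - 2 * inner ℝ z v ^ 2 / (‖z‖ ^ 2 + a) ^ 2 := by
  have hne : ‖z‖ ^ 2 + a ≠ 0 := by positivity
  have hinner : HasFDerivAt (fun z : Plane => inner ℝ z v) (innerSL ℝ v) z :=
    (innerSL ℝ v).hasFDerivAt.congr_of_eventuallyEq
      (Eventually.of_forall fun y => real_inner_comm v y)
  have hinv := (hasDerivAt_inv hne).comp_hasFDerivAt z (hasFDerivAt_norm_sq_add (a := a) z)
  have h := hinner.mul hinv
  rw [secondDeriv2, funext fun y => fderiv_log_norm_sq_add ha y v]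
  refine (DFunLike.congr_fun h.fderiv v).trans ?_
  simp
  field_simp
  ring

/-- The Laplacian of `log (‖z‖² + a) / 2` is `2 a / (‖z‖² + a)²`. -/
lemma laplacian2_log_norm_sq_add (ha : 0 < a) (z : Plane) :
    laplacian2 (fun z : Plane => Real.log (‖z‖ ^ 2 + a) / 2) z = 2 * (a / (‖z‖ ^ 2 + a) ^ 2) := by
  have hne : ‖z‖ ^ 2 + a ≠ 0 := by positivity
  have hnorm : ‖z‖ ^ 2 = z 0 ^ 2 + z 1 ^ 2 := by
    simp [EuclideanSpace.real_norm_sq_eq, Fin.sum_univ_two]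
  rw [laplacian2, secondDeriv2_log_norm_sq_add ha, secondDeriv2_log_norm_sq_add ha]
  simp only [PiLp.norm_single, EuclideanSpace.inner_single_right]
  field_simp
  simp
  linear_combination 2 * hnorm

end RegularizedLog

section SecondDeriv

variable {F : Type*} [NormedAddCommGroup F] [NormedSpace ℝ F] {g : Plane → F}

lemma contDiff_fderiv_apply {n m : WithTop ℕ∞} (hg : ContDiff ℝ n g) (hmn : m + 1 ≤ n)
    (v : Plane) : ContDiff ℝ m (fun z => fderiv ℝ g z v) :=
  (hg.fderiv_right hmn).clm_apply contDiff_const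

lemma continuous_secondDeriv2 (hg : ContDiff ℝ 2 g) (v : Plane) :
    Continuous (fun z => secondDeriv2 g z v) :=
  (contDiff_fderiv_apply (m := 0)
    (contDiff_fderiv_apply (m := 1) hg (by norm_num) v) (by norm_num) v).continuous

lemma continuous_laplacian2 (hg : ContDiff ℝ 2 g) : Continuous (laplacian2 g) :=
  (continuous_secondDeriv2 hg _).add (continuous_secondDeriv2 hg _)

lemma hasCompactSupport_secondDeriv2 (hsupp : HasCompactSupport g) (v : Plane) :
    HasCompactSupport (fun z => secondDeriv2 g z v) :=
  (hsupp.fderiv_apply ℝ v).fderiv_apply ℝ v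

lemma hasCompactSupport_laplacian2 (hsupp : HasCompactSupport g) :
    HasCompactSupport (laplacian2 g) :=
  (hasCompactSupport_secondDeriv2 hsupp _).add (hasCompactSupport_secondDeriv2 hsupp _)

/-- Integration by parts against a compactly supported function. -/
lemma integral_smul_fderiv_eq_neg_of_hasCompactSupport [CompleteSpace F] {φ : Plane → ℝ}
    (hφ : ContDiff ℝ 1 φ) (hg : ContDiff ℝ 1 g) (hsupp : HasCompactSupport g) (v : Plane) :
    ∫ z, φ z • fderiv ℝ g z v = -∫ z, fderiv ℝ φ z v • g z := by
  have hφ' := (contDiff_fderiv_apply (m := 0) hφ (by norm_num) v).continuous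
  have hg' := (contDiff_fderiv_apply (m := 0) hg (by norm_num) v).continuous
  refine integral_smul_fderiv_eq_neg_fderiv_smul_of_integrable
    ((hφ'.smul hg.continuous).integrable_of_hasCompactSupport hsupp.smul_left)
    ((hφ.continuous.smul hg').integrable_of_hasCompactSupport
      (hsupp.fderiv_apply ℝ v).smul_left)
    ((hφ.continuous.smul hg.continuous).integrable_of_hasCompactSupport hsupp.smul_left)
    (fun z _ => hφ.differentiable (by norm_num) z) (fun z _ => hg.differentiable (by norm_num) z)

lemma integral_smul_secondDeriv2 [CompleteSpace F] {φ : Plane → ℝ}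
    (hφ : ContDiff ℝ 2 φ) (hg : ContDiff ℝ 2 g) (hsupp : HasCompactSupport g) (v : Plane) :
    ∫ z, φ z • secondDeriv2 g z v = ∫ z, secondDeriv2 φ z v • g z := by
  have hone : (1 : WithTop ℕ∞) ≤ 2 := by norm_num
  have hφ' := contDiff_fderiv_apply (m := 1) hφ (by norm_num) v
  have hg' := contDiff_fderiv_apply (m := 1) hg (by norm_num) v
  unfold secondDeriv2
  rw [integral_smul_fderiv_eq_neg_of_hasCompactSupport (hφ.of_le hone) hg'
      (hsupp.fderiv_apply ℝ v) v,
    integral_smul_fderiv_eq_neg_of_hasCompactSupport hφ' (hg.of_le hone) hsupp v, neg_neg]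

/-- Green's second identity on the plane, for a compactly supported function. -/
lemma integral_smul_laplacian2 [CompleteSpace F] {φ : Plane → ℝ}
    (hφ : ContDiff ℝ 2 φ) (hg : ContDiff ℝ 2 g) (hsupp : HasCompactSupport g) :
    ∫ z, φ z • laplacian2 g z = ∫ z, laplacian2 φ z • g z := by
  have hleft (v : Plane) : Integrable (fun z => φ z • secondDeriv2 g z v) :=
    (hφ.continuous.smul (continuous_secondDeriv2 hg v)).integrable_of_hasCompactSupport
      (hasCompactSupport_secondDeriv2 hsupp v).smul_left
  have hright (v : Plane) : Integrable (fun z => secondDeriv2 φ z v • g z) :=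
    ((continuous_secondDeriv2 hφ v).smul hg.continuous).integrable_of_hasCompactSupport
      hsupp.smul_left
  simp only [laplacian2, smul_add, add_smul]
  rw [integral_add (hleft _) (hleft _), integral_add (hright _) (hright _),
    integral_smul_secondDeriv2 hφ hg hsupp, integral_smul_secondDeriv2 hφ hg hsupp]

end SecondDeriv

lemma abs_log_sq_add_div_two_le {r a : ℝ} (hr : 0 < r) (ha : 0 < a) (ha1 : a ≤ 1) :
    |Real.log (r ^ 2 + a) / 2| ≤ |Real.log r| + Real.log (r ^ 2 + 1) / 2 := by
  have hlower : Real.log (r ^ 2) ≤ Real.log (r ^ 2 + a) :=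
    Real.log_le_log (by positivity) (by linarith)
  have hupper : Real.log (r ^ 2 + a) ≤ Real.log (r ^ 2 + 1) :=
    Real.log_le_log (by positivity) (by linarith)
  have hnonneg : 0 ≤ Real.log (r ^ 2 + 1) := Real.log_nonneg (by nlinarith)
  rw [Real.log_pow] at hlower
  push_cast at hlower
  rw [abs_le]
  constructor <;> linarith [neg_abs_le (Real.log r), abs_nonneg (Real.log r)]

/-- The regularized logarithms converge to `log ‖·‖` when tested against continuous compactly
supported functions. -/
lemma tendsto_integral_log_norm_sq_add {F : Type*} [NormedAddCommGroup F] [NormedSpace ℝ F]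
    {h : Plane → F} (hh : Continuous h) (hsupp : HasCompactSupport h) :
    Tendsto (fun c : ℝ => ∫ z : Plane, (Real.log (‖z‖ ^ 2 + (c⁻¹) ^ 2) / 2) • h z) atTop
      (𝓝 (∫ z : Plane, Real.log ‖z‖ • h z)) := by
  have hnonzero : ∀ᵐ z : Plane, z ≠ 0 := by simp [ae_iff]
  refine tendsto_integral_filter_of_dominated_convergence
    (fun z => ‖Real.log ‖z‖ • h z‖ + ‖(Real.log (‖z‖ ^ 2 + 1) / 2) • h z‖) ?_ ?_ ?_ ?_
  · filter_upwards [eventually_gt_atTop 0] with c hc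
    exact ((contDiff_log_norm_sq_add (n := 0) (by positivity)).continuous.smul
      hh).aestronglyMeasurable
  · filter_upwards [eventually_ge_atTop 1] with c hc
    filter_upwards [hnonzero] with z hz
    have hc0 : 0 < c := by linarith
    have hle := abs_log_sq_add_div_two_le (norm_pos_iff.2 hz) (a := (c⁻¹) ^ 2) (by positivity)
      (pow_le_one₀ (by positivity) (inv_le_one_of_one_le₀ hc))
    have hnonneg : 0 ≤ Real.log (‖z‖ ^ 2 + 1) / 2 :=
      div_nonneg (Real.log_nonneg (by nlinarith [norm_nonneg z])) two_pos.le
    rw [norm_smul, norm_smul, norm_smul, ← add_mul, Real.norm_eq_abs, Real.norm_eq_abs,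
      Real.norm_of_nonneg hnonneg]
    gcongr
  · refine (locallyIntegrable_log_norm.integrable_smul_right_of_hasCompactSupport hh hsupp).norm.add
      (Integrable.norm ?_)
    exact ((contDiff_log_norm_sq_add (n := 0) one_pos).continuous.smul
      hh).integrable_of_hasCompactSupport hsupp.smul_left
  · filter_upwards [hnonzero] with z hz
    have hz' : ‖z‖ ^ 2 + (0 : ℝ) ^ 2 ≠ 0 := by simpa using hz
    have hlim : Tendsto (fun c : ℝ => Real.log (‖z‖ ^ 2 + (c⁻¹) ^ 2) / 2) atTop
        (𝓝 (Real.log (‖z‖ ^ 2 + (0 : ℝ) ^ 2) / 2)) :=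
      (((tendsto_inv_atTop_zero.pow 2).const_add _).log hz').div_const 2
    have hval : Real.log (‖z‖ ^ 2 + (0 : ℝ) ^ 2) / 2 = Real.log ‖z‖ := by
      simp [Real.log_pow]
    rw [hval] at hlim
    exact hlim.smul_const _

/-- `log ‖·‖ / (2π)` is a fundamental solution of the Laplacian on the plane. -/
lemma integral_log_norm_smul_laplacian2 {F : Type*} [NormedAddCommGroup F] [NormedSpace ℝ F]
    [CompleteSpace F] {g : Plane → F} (hg : ContDiff ℝ 2 g) (hsupp : HasCompactSupport g) :
    ∫ z : Plane, Real.log ‖z‖ • laplacian2 g z = (2 * Real.pi) • g 0 := by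
  refine tendsto_nhds_unique (tendsto_integral_log_norm_sq_add (continuous_laplacian2 hg)
    (hasCompactSupport_laplacian2 hsupp)) ?_
  have hbubble := (tendsto_integral_bubble (hg.continuous.integrable_of_hasCompactSupport hsupp)
    hg.continuous.continuousAt).const_smul (2 * Real.pi)
  refine hbubble.congr' ?_
  filter_upwards [eventually_gt_atTop 0] with c hc
  have hc2 : 0 < (c⁻¹) ^ 2 := by positivity
  rw [integral_smul_laplacian2 (contDiff_log_norm_sq_add hc2) hg hsupp, ← integral_smul]
  congr 1
  ext z
  rw [laplacian2_log_norm_sq_add hc2, smul_smul]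
  congr 1
  have := Real.pi_ne_zero
  field_simp

/-- Directional derivatives of a convolution fall on the smooth compactly supported factor. -/
lemma fderiv_convolution_right_apply {k : Plane → ℝ} (hk : LocallyIntegrable k)
    {F : Type*} [NormedAddCommGroup F] [NormedSpace ℝ F] [CompleteSpace F]
    {g : Plane → F} (hg : ContDiff ℝ 1 g) (hsupp : HasCompactSupport g) (x v : Plane) :
    fderiv ℝ (k ⋆[ContinuousLinearMap.lsmul ℝ ℝ] g : Plane → F) x v =
      (k ⋆[ContinuousLinearMap.lsmul ℝ ℝ] (fun z => fderiv ℝ g z v) : Plane → F) x := by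
  rw [(hsupp.hasFDerivAt_convolution_right _ hk hg x).fderiv]
  exact convolution_precompR_apply _ hk (hsupp.fderiv ℝ) (hg.continuous_fderiv (by norm_num)) x v

lemma laplacian2_convolution_right {k : Plane → ℝ} (hk : LocallyIntegrable k)
    {F : Type*} [NormedAddCommGroup F] [NormedSpace ℝ F] [CompleteSpace F]
    {g : Plane → F} (hg : ContDiff ℝ 2 g) (hsupp : HasCompactSupport g) (x : Plane) :
    laplacian2 (k ⋆[ContinuousLinearMap.lsmul ℝ ℝ] g : Plane → F) x =
      (k ⋆[ContinuousLinearMap.lsmul ℝ ℝ] laplacian2 g : Plane → F) x := by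
  have hsecond (v : Plane) :
      secondDeriv2 (k ⋆[ContinuousLinearMap.lsmul ℝ ℝ] g : Plane → F) x v =
        (k ⋆[ContinuousLinearMap.lsmul ℝ ℝ] (fun z => secondDeriv2 g z v) : Plane → F) x := by
    unfold secondDeriv2
    rw [funext fun y => fderiv_convolution_right_apply hk (hg.of_le (by norm_num)) hsupp y v]
    exact fderiv_convolution_right_apply hk (contDiff_fderiv_apply hg (by norm_num) v)
      (hsupp.fderiv_apply ℝ v) x v
  have hexists (v : Plane) := (hasCompactSupport_secondDeriv2 hsupp v).convolutionExists_right
    (ContinuousLinearMap.lsmul ℝ ℝ : ℝ →L[ℝ] F →L[ℝ] F) hk (continuous_secondDeriv2 hg v)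
  rw [laplacian2, hsecond, hsecond]
  exact (congrFun ((hexists _).distrib_add (hexists _)) x).symm

lemma fderiv_comp_const_sub_apply {F : Type*} [NormedAddCommGroup F] [NormedSpace ℝ F]
    {g : Plane → F} (hg : Differentiable ℝ g) (x y v : Plane) :
    fderiv ℝ (fun y => g (x - y)) y v = -fderiv ℝ g (x - y) v := by
  have h := (hg (x - y)).hasFDerivAt.comp y ((hasFDerivAt_id y).const_sub x)
  refine (DFunLike.congr_fun h.fderiv v).trans ?_
  simp

lemma laplacian2_comp_const_sub {F : Type*} [NormedAddCommGroup F] [NormedSpace ℝ F]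
    {g : Plane → F} (hg : ContDiff ℝ 2 g) (x z : Plane) :
    laplacian2 (fun y => g (x - y)) z = laplacian2 g (x - z) := by
  have hsecond (v : Plane) :
      secondDeriv2 (fun y => g (x - y)) z v = secondDeriv2 g (x - z) v := by
    have hg' := contDiff_fderiv_apply (m := 1) hg (by norm_num) v
    unfold secondDeriv2
    rw [funext fun y => fderiv_comp_const_sub_apply (hg.differentiable (by norm_num)) x y v,
      fderiv_fun_neg, neg_apply,
      fderiv_comp_const_sub_apply (hg'.differentiable (by norm_num)), neg_neg]
  simp only [laplacian2, hsecond]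

lemma laplacian2_const_smul {F : Type*} [NormedAddCommGroup F] [NormedSpace ℝ F]
    (c : ℝ) (g : Plane → F) (x : Plane) : laplacian2 (c • g) x = c • laplacian2 g x := by
  have hsecond (v : Plane) : secondDeriv2 (c • g) x v = c • secondDeriv2 g x v := by
    unfold secondDeriv2
    simp only [fderiv_const_smul_field]
    exact DFunLike.congr_fun
      (congrFun (fderiv_const_smul_field (𝕜 := ℝ) c (f := fun y => fderiv ℝ g y v)) x) v
  rw [laplacian2, hsecond, hsecond, laplacian2, smul_add]

/-- The logarithmic (Newtonian) potential `u(x) = (1/(2π)) ∫ log‖x−y‖ f(y) dy` of a smooth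
compactly supported function `f : ℝ² → ℂ` is twice continuously differentiable and satisfies
`Δu = f` on all of `ℝ²`. -/
theorem newtonian_potential_solves_laplace
    (f : EuclideanSpace ℝ (Fin 2) → ℂ) (hf : ContDiff ℝ (⊤ : ℕ∞) f) (hsupp : HasCompactSupport f)
    (u : EuclideanSpace ℝ (Fin 2) → ℂ)
    (hu : ∀ x, u x = (1 / (2 * Real.pi) : ℂ) *
      ∫ y : EuclideanSpace ℝ (Fin 2), (Real.log ‖x - y‖ : ℂ) * f y) :
    ContDiff ℝ 2 u ∧ ∀ x, laplacian2 u x = f x := by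
  have hf2 : ContDiff ℝ 2 f := hf.of_le (WithTop.coe_le_coe.2 (le_top : (2 : ℕ∞) ≤ ⊤))
  have hconv : u = (1 / (2 * Real.pi) : ℝ) •
      ((fun z => Real.log ‖z‖) ⋆[ContinuousLinearMap.lsmul ℝ ℝ] f : Plane → ℂ) := by
    ext x
    rw [hu, Pi.smul_apply, convolution_lsmul_swap, Complex.real_smul]
    simp
  refine ⟨?_, fun x => ?_⟩
  · rw [hconv]
    have hsmooth := hsupp.contDiff_convolution_right (n := 2)
      (ContinuousLinearMap.lsmul ℝ ℝ : ℝ →L[ℝ] ℂ →L[ℝ] ℂ) locallyIntegrable_log_norm hf2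
    exact hsmooth.const_smul (1 / (2 * Real.pi) : ℝ)
  · rw [hconv, laplacian2_const_smul,
      laplacian2_convolution_right locallyIntegrable_log_norm hf2 hsupp, convolution_lsmul]
    have hreflect : ContDiff ℝ 2 (fun y => f (x - y)) := hf2.comp (contDiff_const.sub contDiff_id)
    have hreflect_supp : HasCompactSupport (fun y => f (x - y)) :=
      hsupp.comp_homeomorph (Homeomorph.subLeft x)
    have hgreen := integral_log_norm_smul_laplacian2 hreflect hreflect_supp
    simp only [laplacian2_comp_const_sub hf2, sub_zero] at hgreen
    rw [hgreen, smul_smul, one_div_mul_cancel (by positivity), one_smul]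
end

section
/- Let u : ℝ² → ℝ be a smooth compactly supported function. Then for every point x = (x₁, x₂) ∈ ℝ² with x₂ > 0, the following representation formula by layer potentials holds: u(x₁,x₂) = (1/(2π)) ∫_{{y₂>0}} log‖x − y‖ · Δu(y) dy + (1/(2π)) ∫_ℝ x₂ u(τ,0) / ((x₁−τ)² + x₂²) dτ + (1/(2π)) ∫_ℝ log‖x − (τ,0)‖ · ∂₂u(τ,0) dτ, where Δu = ∂²u/∂x₁² + ∂²u/∂x₂² and ∂₂u denotes the partial derivative of u in the second variable. -/
open MeasureTheory

/-- The Laplacian of `u : ℝ × ℝ → ℝ` at `x`: sum of the second partial derivatives in the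
two coordinate directions. -/
noncomputable def lapPlane (u : ℝ × ℝ → ℝ) (x : ℝ × ℝ) : ℝ :=
  fderiv ℝ (fun y => fderiv ℝ u y ((1:ℝ), (0:ℝ))) x ((1:ℝ), (0:ℝ)) +
    fderiv ℝ (fun y => fderiv ℝ u y ((0:ℝ), (1:ℝ))) x ((0:ℝ), (1:ℝ))

/-- The partial derivative of `u : ℝ × ℝ → ℝ` in the second variable. -/
noncomputable def d2Plane (u : ℝ × ℝ → ℝ) (x : ℝ × ℝ) : ℝ :=
  fderiv ℝ u x ((0:ℝ), (1:ℝ))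

open Set Filter Topology

/-- The first partial derivative, computed along a horizontal line. -/
lemma hasDerivAt_fst_of_differentiableAt {f : ℝ × ℝ → ℝ} {a b : ℝ}
    (hf : DifferentiableAt ℝ f (a, b)) :
    HasDerivAt (fun t => f (t, b)) (fderiv ℝ f (a, b) (1, 0)) a :=
  hf.hasFDerivAt.comp_hasDerivAt (f := fun t : ℝ => (t, b)) a
    ((hasDerivAt_id a).prodMk (hasDerivAt_const a b))

/-- The second partial derivative, computed along a vertical line. -/
lemma hasDerivAt_snd_of_differentiableAt {f : ℝ × ℝ → ℝ} {a b : ℝ}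
    (hf : DifferentiableAt ℝ f (a, b)) :
    HasDerivAt (fun t => f (a, t)) (fderiv ℝ f (a, b) (0, 1)) b :=
  hf.hasFDerivAt.comp_hasDerivAt (f := fun t : ℝ => (a, t)) b
    ((hasDerivAt_const b a).prodMk (hasDerivAt_id b))

lemma HasCompactSupport.comp_prodMk_right {f : ℝ × ℝ → ℝ} (hf : HasCompactSupport f) (b : ℝ) :
    HasCompactSupport fun t => f (t, b) :=
  HasCompactSupport.intro (hf.isCompact.image continuous_fst) fun t ht =>
    image_eq_zero_of_notMem_tsupport fun h => ht ⟨(t, b), h, rfl⟩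

lemma HasCompactSupport.comp_prodMk_left {f : ℝ × ℝ → ℝ} (hf : HasCompactSupport f) (a : ℝ) :
    HasCompactSupport fun t => f (a, t) :=
  HasCompactSupport.intro (hf.isCompact.image continuous_snd) fun t ht =>
    image_eq_zero_of_notMem_tsupport fun h => ht ⟨(a, t), h, rfl⟩

lemma volume_restrict_upperHalfPlane :
    (volume : Measure (ℝ × ℝ)).restrict {y | 0 < y.2} =
      (volume : Measure ℝ).prod (volume.restrict (Ioi 0)) := by
  rw [show {y : ℝ × ℝ | 0 < y.2} = univ ×ˢ Ioi 0 by ext; simp, Measure.volume_eq_prod,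
    ← Measure.prod_restrict, Measure.restrict_univ]

lemma integrable_fderiv_apply {f : ℝ × ℝ → ℝ} (hf : ContDiff ℝ 1 f)
    (hs : HasCompactSupport f) (v : ℝ × ℝ) : Integrable fun y => fderiv ℝ f y v :=
  ((hf.continuous_fderiv one_ne_zero).clm_apply continuous_const).integrable_of_hasCompactSupport
    (hs.fderiv_apply ℝ v)

lemma setIntegral_upperHalfPlane_fderiv_fst {f : ℝ × ℝ → ℝ} (hf : ContDiff ℝ 1 f)
    (hs : HasCompactSupport f) :
    ∫ y in {y : ℝ × ℝ | 0 < y.2}, fderiv ℝ f y (1, 0) = 0 := by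
  have hint := (integrable_fderiv_apply hf hs (1, 0)).restrict (s := {y : ℝ × ℝ | 0 < y.2})
  rw [volume_restrict_upperHalfPlane] at hint ⊢
  rw [integral_prod_symm _ hint]
  refine integral_eq_zero_of_ae (Eventually.of_forall fun b => ?_)
  refine integral_eq_zero_of_hasDerivAt_of_integrable
    (fun a => hasDerivAt_fst_of_differentiableAt (hf.differentiable one_ne_zero _)) ?_ ?_
  · exact Continuous.integrable_of_hasCompactSupport
      (((hf.continuous_fderiv one_ne_zero).clm_apply continuous_const).comp (by fun_prop))
      ((hs.fderiv_apply ℝ (1, 0)).comp_prodMk_right b)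
  · exact Continuous.integrable_of_hasCompactSupport (hf.continuous.comp (by fun_prop))
      (hs.comp_prodMk_right b)

lemma setIntegral_upperHalfPlane_fderiv_snd {f : ℝ × ℝ → ℝ} (hf : ContDiff ℝ 1 f)
    (hs : HasCompactSupport f) :
    ∫ y in {y : ℝ × ℝ | 0 < y.2}, fderiv ℝ f y (0, 1) = -∫ t, f (t, 0) := by
  have hint := (integrable_fderiv_apply hf hs (0, 1)).restrict (s := {y : ℝ × ℝ | 0 < y.2})
  rw [volume_restrict_upperHalfPlane] at hint ⊢
  rw [integral_prod _ hint, ← integral_neg]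
  congr 1 with a
  rw [← HasCompactSupport.integral_Ioi_deriv_eq (f := fun t => f (a, t))
    (hf.comp (by fun_prop)) (hs.comp_prodMk_left a) 0]
  congr 1 with b
  exact (hasDerivAt_snd_of_differentiableAt (hf.differentiable one_ne_zero _)).deriv.symm

lemma ContDiff.fderiv_apply_const {f : ℝ × ℝ → ℝ} {n : WithTop ℕ∞} (hf : ContDiff ℝ (n + 1) f)
    (v : ℝ × ℝ) : ContDiff ℝ n fun y => fderiv ℝ f y v :=
  (hf.fderiv_right le_rfl).clm_apply contDiff_const

lemma ContDiff.continuous_lapPlane {f : ℝ × ℝ → ℝ} (hf : ContDiff ℝ 2 f) :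
    Continuous (lapPlane f) := by
  have h (v : ℝ × ℝ) : ContDiff ℝ (0 + 1) fun y => fderiv ℝ f y v :=
    ContDiff.fderiv_apply_const (by norm_num; exact hf) v
  exact ((h _).fderiv_apply_const _).continuous.add ((h _).fderiv_apply_const _).continuous

lemma HasCompactSupport.lapPlane {f : ℝ × ℝ → ℝ} (hf : HasCompactSupport f) :
    HasCompactSupport (lapPlane f) :=
  ((hf.fderiv_apply ℝ _).fderiv_apply ℝ _).add ((hf.fderiv_apply ℝ _).fderiv_apply ℝ _)

/-- **Green's second identity** on the upper half-plane, for a compactly supported function. -/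
theorem green_identity_upperHalfPlane {u g : ℝ × ℝ → ℝ} (hu : ContDiff ℝ 2 u)
    (hg : ContDiff ℝ 2 g) (hs : HasCompactSupport u) :
    ∫ y in {y : ℝ × ℝ | 0 < y.2}, (g y * lapPlane u y - u y * lapPlane g y) =
      -∫ t, (g (t, 0) * d2Plane u (t, 0) - u (t, 0) * d2Plane g (t, 0)) := by
  have hu' (v : ℝ × ℝ) : ContDiff ℝ 1 fun y => fderiv ℝ u y v :=
    ContDiff.fderiv_apply_const (by norm_num; exact hu) v
  have hg' (v : ℝ × ℝ) : ContDiff ℝ 1 fun y => fderiv ℝ g y v :=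
    ContDiff.fderiv_apply_const (by norm_num; exact hg) v
  have hu1 : ContDiff ℝ 1 u := hu.of_le (by norm_num)
  have hg1 : ContDiff ℝ 1 g := hg.of_le (by norm_num)
  let F (v : ℝ × ℝ) (y : ℝ × ℝ) : ℝ := g y * fderiv ℝ u y v - u y * fderiv ℝ g y v
  have hF (v : ℝ × ℝ) : ContDiff ℝ 1 (F v) := (hg1.mul (hu' v)).sub (hu1.mul (hg' v))
  have hFs (v : ℝ × ℝ) : HasCompactSupport (F v) :=
    ((hs.fderiv_apply ℝ v).mul_left (f := g)).sub (hs.mul_right (f' := fun y => fderiv ℝ g y v))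
  have hdF (v y : ℝ × ℝ) : fderiv ℝ (F v) y v =
      g y * fderiv ℝ (fun z => fderiv ℝ u z v) y v -
        u y * fderiv ℝ (fun z => fderiv ℝ g z v) y v := by
    have a1 := (hu1.differentiable one_ne_zero y).hasFDerivAt
    have a2 := (hg1.differentiable one_ne_zero y).hasFDerivAt
    have a3 := ((hu' v).differentiable one_ne_zero y).hasFDerivAt
    have a4 := ((hg' v).differentiable one_ne_zero y).hasFDerivAt
    have h := ((a2.mul a3).sub (a1.mul a4)).fderiv
    have h2 : fderiv ℝ (F v) y v = _ := congrArg (fun L : ℝ × ℝ →L[ℝ] ℝ => L v) h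
    rw [h2]
    simp
    ring
  calc _ = ∫ y in {y : ℝ × ℝ | 0 < y.2},
        (fderiv ℝ (F (1, 0)) y (1, 0) + fderiv ℝ (F (0, 1)) y (0, 1)) := by
        congr 1 with y
        rw [hdF, hdF, lapPlane, lapPlane]
        ring
    _ = _ := by
        rw [integral_add (integrable_fderiv_apply (hF _) (hFs _) _).restrict
            (integrable_fderiv_apply (hF _) (hFs _) _).restrict,
          setIntegral_upperHalfPlane_fderiv_fst (hF _) (hFs _),
          setIntegral_upperHalfPlane_fderiv_snd (hF _) (hFs _), zero_add]
        rfl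

/-- The smooth approximation `log √(‖x - y‖² + ε²)` of the logarithmic kernel `log ‖x - y‖`. -/
noncomputable def regLog (x : ℝ × ℝ) (ε : ℝ) (y : ℝ × ℝ) : ℝ :=
  Real.log ((x.1 - y.1) ^ 2 + (x.2 - y.2) ^ 2 + ε ^ 2) / 2

section regLog

variable {x : ℝ × ℝ} {ε : ℝ}

lemma regLog_arg_pos (hε : ε ≠ 0) (y : ℝ × ℝ) :
    0 < (x.1 - y.1) ^ 2 + (x.2 - y.2) ^ 2 + ε ^ 2 := by positivity

lemma contDiff_regLog (hε : ε ≠ 0) {n : WithTop ℕ∞} : ContDiff ℝ n (regLog x ε) := by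
  unfold regLog
  exact (ContDiff.log (by fun_prop) fun y => (regLog_arg_pos hε y).ne').div_const 2

lemma fderiv_regLog_fst (hε : ε ≠ 0) (y : ℝ × ℝ) :
    fderiv ℝ (regLog x ε) y (1, 0) =
      (y.1 - x.1) / ((x.1 - y.1) ^ 2 + (x.2 - y.2) ^ 2 + ε ^ 2) := by
  have hpos := regLog_arg_pos (x := x) hε y
  refine (hasDerivAt_fst_of_differentiableAt
    ((contDiff_regLog hε (n := 1)).differentiable one_ne_zero (y.1, y.2))).unique ?_
  have h := (((((hasDerivAt_id y.1).const_sub x.1).pow 2).add_const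
    ((x.2 - y.2) ^ 2)).add_const (ε ^ 2)).log hpos.ne' |>.div_const 2
  refine h.congr_deriv ?_
  simp
  field_simp
  ring

lemma fderiv_regLog_snd (hε : ε ≠ 0) (y : ℝ × ℝ) :
    fderiv ℝ (regLog x ε) y (0, 1) =
      (y.2 - x.2) / ((x.1 - y.1) ^ 2 + (x.2 - y.2) ^ 2 + ε ^ 2) := by
  have hpos := regLog_arg_pos (x := x) hε y
  refine (hasDerivAt_snd_of_differentiableAt
    ((contDiff_regLog hε (n := 1)).differentiable one_ne_zero (y.1, y.2))).unique ?_
  have h := (((((hasDerivAt_id y.2).const_sub x.2).pow 2).const_add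
    ((x.1 - y.1) ^ 2)).add_const (ε ^ 2)).log hpos.ne' |>.div_const 2
  refine h.congr_deriv ?_
  simp
  field_simp
  ring

lemma lapPlane_regLog (hε : ε ≠ 0) (y : ℝ × ℝ) :
    lapPlane (regLog x ε) y =
      2 * ε ^ 2 / ((x.1 - y.1) ^ 2 + (x.2 - y.2) ^ 2 + ε ^ 2) ^ 2 := by
  have hpos := regLog_arg_pos (x := x) hε y
  have hd (v : ℝ × ℝ) : Differentiable ℝ fun z => fderiv ℝ (regLog x ε) z v :=
    (ContDiff.fderiv_apply_const (n := 1) (contDiff_regLog hε) v).differentiable one_ne_zero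
  have h1 : fderiv ℝ (fun z => fderiv ℝ (regLog x ε) z (1, 0)) y (1, 0) =
      ((x.2 - y.2) ^ 2 + ε ^ 2 - (x.1 - y.1) ^ 2) /
        ((x.1 - y.1) ^ 2 + (x.2 - y.2) ^ 2 + ε ^ 2) ^ 2 := by
    refine (hasDerivAt_fst_of_differentiableAt (hd (1, 0) (y.1, y.2))).unique ?_
    simp only [fderiv_regLog_fst hε]
    refine (((hasDerivAt_id y.1).sub_const x.1).div (((((hasDerivAt_id y.1).const_sub x.1).pow
      2).add_const ((x.2 - y.2) ^ 2)).add_const (ε ^ 2)) hpos.ne').congr_deriv ?_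
    simp
    ring
  have h2 : fderiv ℝ (fun z => fderiv ℝ (regLog x ε) z (0, 1)) y (0, 1) =
      ((x.1 - y.1) ^ 2 + ε ^ 2 - (x.2 - y.2) ^ 2) /
        ((x.1 - y.1) ^ 2 + (x.2 - y.2) ^ 2 + ε ^ 2) ^ 2 := by
    refine (hasDerivAt_snd_of_differentiableAt (hd (0, 1) (y.1, y.2))).unique ?_
    simp only [fderiv_regLog_snd hε]
    refine (((hasDerivAt_id y.2).sub_const x.2).div (((((hasDerivAt_id y.2).const_sub x.2).pow
      2).const_add ((x.1 - y.1) ^ 2)).add_const (ε ^ 2)) hpos.ne').congr_deriv ?_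
    simp
    ring
  rw [lapPlane, h1, h2]
  ring

end regLog

lemma integral_Ioi_mul_two_div_sq : ∫ r in Ioi (0 : ℝ), r * (2 / (1 + r ^ 2) ^ 2) = 1 := by
  have h := integral_Ioi_of_hasDerivAt_of_nonneg' (a := 0) (l := 0)
    (g := fun r : ℝ => -(1 + r ^ 2)⁻¹) (g' := fun r => r * (2 / (1 + r ^ 2) ^ 2)) ?_ ?_ ?_
  · simpa using h
  · intro r _
    have hne : 1 + r ^ 2 ≠ 0 := by positivity
    refine ((((hasDerivAt_id r).pow 2).const_add 1).inv hne).neg.congr_deriv ?_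
    simp
    field_simp
  · intro r hr
    have : (0 : ℝ) < r := hr
    positivity
  · simpa using (tendsto_inv_atTop_zero.comp
      (tendsto_atTop_add_const_left _ (1 : ℝ) (tendsto_pow_atTop (α := ℝ) two_ne_zero))).neg

lemma integral_two_div_one_add_sq_add_sq_sq :
    ∫ z : ℝ × ℝ, 2 / (1 + z.1 ^ 2 + z.2 ^ 2) ^ 2 = 2 * Real.pi := by
  rw [← integral_comp_polarCoord_symm, polarCoord_target]
  have h (p : ℝ × ℝ) : p.1 • (2 / (1 + (polarCoord.symm p).1 ^ 2 +
      (polarCoord.symm p).2 ^ 2) ^ 2) = p.1 * (2 / (1 + p.1 ^ 2) ^ 2) * 1 := by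
    have : 1 + (p.1 * Real.cos p.2) ^ 2 + (p.1 * Real.sin p.2) ^ 2 = 1 + p.1 ^ 2 := by
      linear_combination p.1 ^ 2 * Real.sin_sq_add_cos_sq p.2
    simp [polarCoord_symm_apply, this]
  simp_rw [h]
  rw [Measure.volume_eq_prod, setIntegral_prod_mul (fun r : ℝ => r * (2 / (1 + r ^ 2) ^ 2))
    (fun _ => (1 : ℝ)), integral_Ioi_mul_two_div_sq]
  simp [Real.pi_pos.le]
  ring

lemma integrable_two_div_one_add_sq_add_sq_sq :
    Integrable fun z : ℝ × ℝ => 2 / (1 + z.1 ^ 2 + z.2 ^ 2) ^ 2 := by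
  refine Classical.not_not.1 (mt integral_undef ?_)
  rw [integral_two_div_one_add_sq_add_sq_sq]
  positivity

/-- The rescaled kernels `2 ε² / (‖x - y‖² + ε²)²` concentrate at `x`. -/
lemma tendsto_integral_mul_approxIdentity {x : ℝ × ℝ} {f : ℝ × ℝ → ℝ} (hx : ContinuousAt f x)
    (hm : AEStronglyMeasurable f) {C : ℝ} (hC : ∀ y, ‖f y‖ ≤ C) :
    Tendsto (fun ε : ℝ => ∫ y, f y *
        (2 * ε ^ 2 / ((x.1 - y.1) ^ 2 + (x.2 - y.2) ^ 2 + ε ^ 2) ^ 2)) (𝓝[>] 0)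
      (𝓝 (2 * Real.pi * f x)) := by
  have hscale : ∀ᶠ ε : ℝ in 𝓝[>] 0,
      ∫ z : ℝ × ℝ, f (x + ε • z) * (2 / (1 + z.1 ^ 2 + z.2 ^ 2) ^ 2) = ∫ y, f y *
        (2 * ε ^ 2 / ((x.1 - y.1) ^ 2 + (x.2 - y.2) ^ 2 + ε ^ 2) ^ 2) := by
    filter_upwards [self_mem_nhdsWithin] with ε hε
    have hε : 0 < ε := hε
    rw [← integral_add_left_eq_self (fun y => f y * _) x]
    have h := Measure.integral_comp_smul volume (fun z : ℝ × ℝ => f (x + z) *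
      (2 * ε ^ 2 / ((x.1 - (x + z).1) ^ 2 + (x.2 - (x + z).2) ^ 2 + ε ^ 2) ^ 2)) ε
    have hfr : Module.finrank ℝ (ℝ × ℝ) = 2 := by simp
    rw [hfr, abs_of_pos (by positivity), smul_eq_mul, eq_inv_mul_iff_mul_eq₀ (by positivity),
      ← integral_const_mul] at h
    rw [← h]
    congr 1 with z
    have hz : (x.1 - (x + ε • z).1) ^ 2 + (x.2 - (x + ε • z).2) ^ 2 + ε ^ 2 =
        ε ^ 2 * (1 + z.1 ^ 2 + z.2 ^ 2) := by
      simp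
      ring
    have hpos : 0 < 1 + z.1 ^ 2 + z.2 ^ 2 := by positivity
    rw [hz]
    field_simp
  refine Tendsto.congr' hscale ?_
  have hlim : 2 * Real.pi * f x =
      ∫ z : ℝ × ℝ, f x * (2 / (1 + z.1 ^ 2 + z.2 ^ 2) ^ 2) := by
    rw [integral_const_mul, integral_two_div_one_add_sq_add_sq_sq, mul_comm]
  rw [hlim]
  refine tendsto_integral_filter_of_dominated_convergence
    (fun z : ℝ × ℝ => C * (2 / (1 + z.1 ^ 2 + z.2 ^ 2) ^ 2)) ?_ ?_
    (integrable_two_div_one_add_sq_add_sq_sq.const_mul C) ?_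
  · filter_upwards [self_mem_nhdsWithin] with ε hε
    have hε : 0 < ε := hε
    refine AEStronglyMeasurable.mul ?_ integrable_two_div_one_add_sq_add_sq_sq.1
    have hq : Measure.QuasiMeasurePreserving (fun z : ℝ × ℝ => x + ε • z) :=
      (measurePreserving_add_left volume x).quasiMeasurePreserving.comp
        (Measure.quasiMeasurePreserving_smul volume hε.ne')
    exact hm.comp_quasiMeasurePreserving hq
  · refine Eventually.of_forall fun ε => Eventually.of_forall fun z => ?_
    rw [norm_mul, Real.norm_of_nonneg (by positivity : 0 ≤ 2 / (1 + z.1 ^ 2 + z.2 ^ 2) ^ 2)]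
    exact mul_le_mul_of_nonneg_right (hC _) (by positivity)
  · refine Eventually.of_forall fun z => Tendsto.mul_const _ ?_
    refine hx.tendsto.comp (tendsto_nhdsWithin_of_tendsto_nhds ?_)
    have : Continuous fun ε : ℝ => x + ε • z := by fun_prop
    simpa using this.tendsto 0

lemma abs_regLog_le {x y : ℝ × ℝ} {ε : ℝ} (hy : y.1 ≠ x.1) (hε₀ : 0 ≤ ε) (hε₁ : ε ≤ 1) :
    |regLog x ε y| ≤ |Real.log (x.1 - y.1)| +
      Real.log ((x.1 - y.1) ^ 2 + (x.2 - y.2) ^ 2 + 1) / 2 := by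
  have h0 : 0 < (x.1 - y.1) ^ 2 := by
    have := sub_ne_zero.2 hy.symm
    positivity
  have hlower : 2 * Real.log (x.1 - y.1) ≤
      Real.log ((x.1 - y.1) ^ 2 + (x.2 - y.2) ^ 2 + ε ^ 2) := by
    have h := Real.log_le_log h0 (show (x.1 - y.1) ^ 2 ≤
      (x.1 - y.1) ^ 2 + (x.2 - y.2) ^ 2 + ε ^ 2 by nlinarith [sq_nonneg (x.2 - y.2)])
    simpa [Real.log_pow] using h
  have hupper : Real.log ((x.1 - y.1) ^ 2 + (x.2 - y.2) ^ 2 + ε ^ 2) ≤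
      Real.log ((x.1 - y.1) ^ 2 + (x.2 - y.2) ^ 2 + 1) :=
    Real.log_le_log (by positivity) (by nlinarith)
  have hone : 0 ≤ Real.log ((x.1 - y.1) ^ 2 + (x.2 - y.2) ^ 2 + 1) :=
    Real.log_nonneg (by nlinarith [sq_nonneg (x.2 - y.2)])
  have h1 := neg_abs_le (Real.log (x.1 - y.1))
  have h2 := abs_nonneg (Real.log (x.1 - y.1))
  rw [regLog, abs_le]
  constructor <;> linarith

lemma integrable_abs_log_fst_mul (a : ℝ) {f : ℝ × ℝ → ℝ} (hf : Continuous f)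
    (hs : HasCompactSupport f) :
    Integrable fun y : ℝ × ℝ => |Real.log (a - y.1)| * |f y| := by
  obtain ⟨R, hR, hsub⟩ := hs.isCompact.isBounded.subset_closedBall_lt 0 0
  obtain ⟨C, hC⟩ := hf.bounded_above_of_compact_support hs
  have hlog : IntegrableOn (fun t => |Real.log (a - t)|) (Icc (-R) R) := by
    have h := (intervalIntegral.intervalIntegrable_log' (a := a + R) (b := a - R)).comp_sub_left a
    simp only [sub_add_cancel_left, sub_sub_cancel] at h
    exact ((intervalIntegrable_iff_integrableOn_Icc_of_le (by linarith)).1 h).abs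
  have hbound := (hlog.integrable_indicator measurableSet_Icc).mul_prod
    (integrable_indicator_iff measurableSet_Icc |>.2
      (integrableOn_const (μ := volume) (s := Icc (-R) R) (C := C) (by simp)))
  refine hbound.mono' ?_ (Eventually.of_forall fun y => ?_)
  · have hm : Measurable fun y : ℝ × ℝ => |Real.log (a - y.1)| := by fun_prop
    exact (hm.mul hf.abs.measurable).aestronglyMeasurable
  · rw [Real.norm_of_nonneg (by positivity)]
    by_cases hy : y ∈ tsupport f
    · have hyR : ‖y‖ ≤ R := by simpa using hsub hy
      have h1 : y.1 ∈ Icc (-R) R := abs_le.1 ((norm_fst_le y).trans hyR)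
      have h2 : y.2 ∈ Icc (-R) R := abs_le.1 ((norm_snd_le y).trans hyR)
      rw [indicator_of_mem h1, indicator_of_mem h2]
      exact mul_le_mul_of_nonneg_left (hC y) (abs_nonneg _)
    · rw [image_eq_zero_of_notMem_tsupport hy, abs_zero, mul_zero]
      exact mul_nonneg (indicator_nonneg (fun _ _ => abs_nonneg _) _)
        (indicator_nonneg (fun _ _ => (norm_nonneg _).trans (hC 0)) _)

lemma ae_fst_ne (a : ℝ) : ∀ᵐ y : ℝ × ℝ, y.1 ≠ a := by
  rw [Measure.volume_eq_prod]
  exact Measure.quasiMeasurePreserving_fst.ae (Measure.ae_ne volume a)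

/-- The regularised Newton potential converges to the Newton potential. -/
lemma tendsto_setIntegral_regLog_mul (x : ℝ × ℝ) {f : ℝ × ℝ → ℝ} (hf : Continuous f)
    (hs : HasCompactSupport f) (s : Set (ℝ × ℝ)) :
    Tendsto (fun ε => ∫ y in s, regLog x ε y * f y) (𝓝[>] 0)
      (𝓝 (∫ y in s, Real.log (Real.sqrt ((x.1 - y.1) ^ 2 + (x.2 - y.2) ^ 2)) * f y)) := by
  have hone : Integrable fun y : ℝ × ℝ =>
      Real.log ((x.1 - y.1) ^ 2 + (x.2 - y.2) ^ 2 + 1) / 2 * |f y| := by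
    refine Continuous.integrable_of_hasCompactSupport (Continuous.mul ?_ hf.abs)
      (hs.abs.mul_left)
    exact (Continuous.log (by fun_prop) fun y => by positivity).div_const 2
  refine tendsto_integral_filter_of_dominated_convergence
    (fun y => |Real.log (x.1 - y.1)| * |f y| +
      Real.log ((x.1 - y.1) ^ 2 + (x.2 - y.2) ^ 2 + 1) / 2 * |f y|) ?_ ?_
    ((integrable_abs_log_fst_mul x.1 hf hs).add hone).restrict ?_
  · filter_upwards [self_mem_nhdsWithin] with ε hε
    have hc : Continuous (regLog x ε) :=
      (contDiff_regLog (n := 0) (ne_of_gt hε)).continuous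
    exact (hc.mul hf).aestronglyMeasurable
  · filter_upwards [Ioc_mem_nhdsGT one_pos] with ε hε
    filter_upwards [ae_restrict_of_ae (ae_fst_ne x.1)] with y hy
    rw [← add_mul, norm_mul]
    exact mul_le_mul_of_nonneg_right (abs_regLog_le hy hε.1.le hε.2) (abs_nonneg _)
  · filter_upwards [ae_restrict_of_ae (ae_fst_ne x.1)] with y hy
    refine Tendsto.mul_const _ (tendsto_nhdsWithin_of_tendsto_nhds ?_)
    have h0 : 0 < (x.1 - y.1) ^ 2 + (x.2 - y.2) ^ 2 := by
      have := sub_ne_zero.2 hy.symm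
      positivity
    have h : ContinuousAt (fun ε : ℝ => regLog x ε y) 0 := by
      unfold regLog
      exact (ContinuousAt.log (by fun_prop) (by simpa using h0.ne')).div_const 2
    simpa [regLog, Real.log_sqrt h0.le] using h.tendsto

/-- Integrals of a jointly continuous kernel against a compactly supported function depend
continuously on the parameter. -/
lemma tendsto_integral_mul_of_continuous {k : ℝ → ℝ → ℝ} (hk : Continuous k.uncurry)
    {f : ℝ → ℝ} (hf : Continuous f) (hs : HasCompactSupport f) :
    Tendsto (fun ε => ∫ t, k ε t * f t) (𝓝[>] 0) (𝓝 (∫ t, k 0 t * f t)) := by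
  have h := continuousOn_integral_of_compact_support (s := univ) (μ := volume)
    (f := fun ε t => k ε t * f t) hs.isCompact
    ((hk.mul (hf.comp continuous_snd)).continuousOn) fun ε t _ ht => by
      rw [image_eq_zero_of_notMem_tsupport ht, mul_zero]
  exact tendsto_nhdsWithin_of_tendsto_nhds ((continuousOn_univ.1 h).tendsto 0)

/-- Representation of a smooth compactly supported function on the upper half-plane by the
Newton potential of its Laplacian, the double-layer potential of its Dirichlet trace and the
single-layer potential of its Neumann trace. -/
theorem layer_potential_representation_upper_half_plane
    (u : ℝ × ℝ → ℝ) (hu : ContDiff ℝ (⊤ : ℕ∞) u) (hsupp : HasCompactSupport u)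
    (x₁ x₂ : ℝ) (hx₂ : 0 < x₂) :
    u (x₁, x₂) =
      (1 / (2 * Real.pi)) *
          (∫ y in {y : ℝ × ℝ | 0 < y.2},
            Real.log (Real.sqrt ((x₁ - y.1) ^ 2 + (x₂ - y.2) ^ 2)) * lapPlane u y) +
        (1 / (2 * Real.pi)) * (∫ τ : ℝ, x₂ * u (τ, 0) / ((x₁ - τ) ^ 2 + x₂ ^ 2)) +
          (1 / (2 * Real.pi)) *
            (∫ τ : ℝ, Real.log (Real.sqrt ((x₁ - τ) ^ 2 + x₂ ^ 2)) * d2Plane u (τ, 0)) := by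
  have hu2 : ContDiff ℝ 2 u := hu.of_le (WithTop.coe_le_coe.2 (le_top : (2 : ℕ∞) ≤ ⊤))
  have hlap := hu2.continuous_lapPlane
  have hd2 : Continuous (d2Plane u) :=
    (hu2.continuous_fderiv (by norm_num)).clm_apply continuous_const
  have hd2s : HasCompactSupport (d2Plane u) := hsupp.fderiv_apply ℝ _
  have hmeas : MeasurableSet {y : ℝ × ℝ | 0 < y.2} :=
    measurableSet_lt measurable_const measurable_snd
  have hopen : IsOpen {y : ℝ × ℝ | 0 < y.2} := isOpen_lt continuous_const continuous_snd
  have hpos (ε t : ℝ) : 0 < (x₁ - t) ^ 2 + x₂ ^ 2 + ε ^ 2 := by positivity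
  have hu0 : Continuous fun t : ℝ => u (t, 0) := hu.continuous.comp (by fun_prop)
  have hd20 : Continuous fun t : ℝ => d2Plane u (t, 0) := hd2.comp (by fun_prop)
  have hklog : Continuous (Function.uncurry fun ε t : ℝ => regLog (x₁, x₂) ε (t, 0)) := by
    unfold regLog
    exact (Continuous.log (by fun_prop) fun p => by simpa using (hpos p.1 p.2).ne').div_const 2
  have hkdl : Continuous (Function.uncurry fun ε t : ℝ =>
      x₂ / ((x₁ - t) ^ 2 + x₂ ^ 2 + ε ^ 2)) :=
    Continuous.div continuous_const (by fun_prop) fun p => (hpos p.1 p.2).ne'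
  have hN := tendsto_setIntegral_regLog_mul (x₁, x₂) hlap hsupp.lapPlane {y : ℝ × ℝ | 0 < y.2}
  have hS := tendsto_integral_mul_of_continuous hklog hd20 (hd2s.comp_prodMk_right 0)
  have hD := tendsto_integral_mul_of_continuous hkdl hu0 (hsupp.comp_prodMk_right 0)
  obtain ⟨C, hC⟩ := hu.continuous.bounded_above_of_compact_support hsupp
  have hx : (x₁, x₂) ∈ {y : ℝ × ℝ | 0 < y.2} := hx₂
  have hP := tendsto_integral_mul_approxIdentity (x := (x₁, x₂))
    (f := indicator {y : ℝ × ℝ | 0 < y.2} u)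
    (hu.continuous.continuousAt.congr (by
      filter_upwards [hopen.mem_nhds hx] with y hy
      exact (indicator_of_mem (s := {y : ℝ × ℝ | 0 < y.2}) hy u).symm))
    (hu.continuous.aestronglyMeasurable.indicator hmeas)
    (fun y => (norm_indicator_le_norm_self u y).trans (hC y))
  rw [indicator_of_mem hx] at hP
  have hgreen : ∀ᶠ ε : ℝ in 𝓝[>] 0,
      (∫ y in {y : ℝ × ℝ | 0 < y.2}, regLog (x₁, x₂) ε y * lapPlane u y) +
        (∫ t, x₂ / ((x₁ - t) ^ 2 + x₂ ^ 2 + ε ^ 2) * u (t, 0)) +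
        (∫ t, regLog (x₁, x₂) ε (t, 0) * d2Plane u (t, 0)) =
      ∫ y, indicator {y : ℝ × ℝ | 0 < y.2} u y *
        (2 * ε ^ 2 / ((x₁ - y.1) ^ 2 + (x₂ - y.2) ^ 2 + ε ^ 2) ^ 2) := by
    filter_upwards [self_mem_nhdsWithin] with ε hε
    have hε : ε ≠ 0 := ne_of_gt hε
    have hg : ContDiff ℝ 2 (regLog (x₁, x₂) ε) := contDiff_regLog hε
    have h := green_identity_upperHalfPlane hu2 hg hsupp
    have hint1 : Integrable fun y => regLog (x₁, x₂) ε y * lapPlane u y :=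
      (hg.continuous.mul hlap).integrable_of_hasCompactSupport hsupp.lapPlane.mul_left
    have hint2 : Integrable fun y => u y * lapPlane (regLog (x₁, x₂) ε) y :=
      (hu.continuous.mul hg.continuous_lapPlane).integrable_of_hasCompactSupport hsupp.mul_right
    rw [integral_sub hint1.restrict hint2.restrict] at h
    have hbd : ∫ t, (regLog (x₁, x₂) ε (t, 0) * d2Plane u (t, 0) -
        u (t, 0) * d2Plane (regLog (x₁, x₂) ε) (t, 0)) =
        (∫ t, regLog (x₁, x₂) ε (t, 0) * d2Plane u (t, 0)) +
          ∫ t, x₂ / ((x₁ - t) ^ 2 + x₂ ^ 2 + ε ^ 2) * u (t, 0) := by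
      rw [← integral_add]
      · congr 1 with t
        rw [d2Plane.eq_def (regLog _ _), fderiv_regLog_snd hε]
        simp only [zero_sub, sub_zero]
        ring
      · exact ((hklog.comp (by fun_prop : Continuous fun t : ℝ => (ε, t))).mul
          hd20).integrable_of_hasCompactSupport (hd2s.comp_prodMk_right 0).mul_left
      · exact ((hkdl.comp (by fun_prop : Continuous fun t : ℝ => (ε, t))).mul
          hu0).integrable_of_hasCompactSupport (hsupp.comp_prodMk_right 0).mul_left
    have hind : ∫ y, indicator {y : ℝ × ℝ | 0 < y.2} u y *
        (2 * ε ^ 2 / ((x₁ - y.1) ^ 2 + (x₂ - y.2) ^ 2 + ε ^ 2) ^ 2) =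
        ∫ y in {y : ℝ × ℝ | 0 < y.2}, u y * lapPlane (regLog (x₁, x₂) ε) y := by
      rw [← integral_indicator hmeas]
      congr 1 with y
      by_cases hy : y ∈ {y : ℝ × ℝ | 0 < y.2}
      · rw [indicator_of_mem hy, indicator_of_mem hy, lapPlane_regLog hε]
      · rw [indicator_of_notMem hy, indicator_of_notMem hy, zero_mul]
    rw [hbd] at h
    rw [hind]
    linarith
  have hmain := tendsto_nhds_unique (((hN.add hD).add hS).congr' hgreen) hP
  have hDeq : ∫ t, x₂ / ((x₁ - t) ^ 2 + x₂ ^ 2 + 0 ^ 2) * u (t, 0) =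
      ∫ t, x₂ * u (t, 0) / ((x₁ - t) ^ 2 + x₂ ^ 2) := by
    congr 1 with t
    rw [zero_pow two_ne_zero, add_zero, div_mul_eq_mul_div]
  have hSeq : ∫ t, regLog (x₁, x₂) 0 (t, 0) * d2Plane u (t, 0) =
      ∫ t, Real.log (Real.sqrt ((x₁ - t) ^ 2 + x₂ ^ 2)) * d2Plane u (t, 0) := by
    congr 1 with t
    rw [Real.log_sqrt (by positivity), regLog]
    simp
  rw [hDeq, hSeq] at hmain
  rw [← mul_add, ← mul_add, hmain]
  field_simp
end
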